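/- Assume Ω satisfies SR-propagation, the observed values T̂_α are nonzero for all α ∈ Ω, and T ∈ ℝ^⟦N⟧ is the unique rank-one completion. Then for any positive reals ξ_β (β ∈ ⟦N⟧) and any η > 0 there exist positive constants η_β ∈ [ξ_β − η, ξ_β], indices α_β ∈ Ω, a polynomial p̃ ∈ Σ_{N,2}, and σ ∈ Σ_{N,2} admitting a Gram matrix of rank N, such that Σ_{β∈⟦N⟧} ξ_β (x_β² − T_β²) = Σ_{β∈⟦N⟧} η_β (x_β − (T_β/T_{α_β}) x_{α_β})² + p̃ mod (I_2 + J_2), and this expression equals σ mod (I_2 + J_2). -/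

import Mathlib

namespace RankOneTC

open scoped BigOperators
open MeasureTheory

/-- The index set `⟦N⟧ = [n 0] × ⋯ × [n (d-1)]`. -/
abbrev Idx {d : ℕ} (n : Fin d → ℕ) : Type := ∀ i : Fin d, Fin (n i)

/-- A tensor is rank one if it is an outer product of `d` vectors. -/
def IsRankOne {d : ℕ} {n : Fin d → ℕ} (T : Idx n → ℝ) : Prop :=
  ∃ u : ∀ i : Fin d, Fin (n i) → ℝ, ∀ α : Idx n, T α = ∏ i : Fin d, u i (α i)

/-- `Ω` satisfies unique recovery: for any nonzero observed values, the rank-one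
completion problem is infeasible or has exactly one solution. -/
def UniqueRecovery {d : ℕ} {n : Fin d → ℕ} (Ω : Set (Idx n)) : Prop :=
  ∀ That : Idx n → ℝ, (∀ α ∈ Ω, That α ≠ 0) →
    {T : Idx n → ℝ | IsRankOne T ∧ ∀ α ∈ Ω, T α = That α}.Subsingleton

/-- The 𝔽₂ vector `v_α`, the concatenation of indicator vectors of the coordinates. -/
def vF2 {d : ℕ} {n : Fin d → ℕ} (α : Idx n) : (Σ i : Fin d, Fin (n i)) → ZMod 2 :=
  fun s => if α s.1 = s.2 then 1 else 0

/-- A generalized square: four distinct tuples whose `v`-vectors sum to zero over 𝔽₂. -/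
def IsGenSquare {d : ℕ} {n : Fin d → ℕ} (α₁ α₂ α₃ α₄ : Idx n) : Prop :=
  [α₁, α₂, α₃, α₄].Nodup ∧ vF2 α₁ + vF2 α₂ + vF2 α₃ + vF2 α₄ = 0

/-- A square `{α₁,α₂;α₃,α₄}`: four distinct tuples with coordinatewise equal max and min
of the two opposite pairs. -/
def IsSquare {d : ℕ} {n : Fin d → ℕ} (α₁ α₂ α₃ α₄ : Idx n) : Prop :=
  [α₁, α₂, α₃, α₄].Nodup ∧
    ∀ k : Fin d, max (α₁ k) (α₂ k) = max (α₃ k) (α₄ k) ∧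
      min (α₁ k) (α₂ k) = min (α₃ k) (α₄ k)

/-- The GS-propagated set `𝒫_GS(Ω)` as an inductive predicate. -/
inductive PGS {d : ℕ} {n : Fin d → ℕ} (Ω : Set (Idx n)) : Idx n → Prop
  | base {α : Idx n} : α ∈ Ω → PGS Ω α
  | prop {α₁ α₂ α₃ β : Idx n} : IsGenSquare α₁ α₂ α₃ β →
      PGS Ω α₁ → PGS Ω α₂ → PGS Ω α₃ → PGS Ω β

def GSPropagation {d : ℕ} {n : Fin d → ℕ} (Ω : Set (Idx n)) : Prop :=
  ∀ β : Idx n, PGS Ω β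

/-- The S-propagated set `𝒫_S(Ω)` as an inductive predicate. -/
inductive PS {d : ℕ} {n : Fin d → ℕ} (Ω : Set (Idx n)) : Idx n → Prop
  | base {α : Idx n} : α ∈ Ω → PS Ω α
  | prop {α₁ α₂ α₃ β : Idx n} : IsSquare α₁ α₂ α₃ β →
      PS Ω α₁ → PS Ω α₂ → PS Ω α₃ → PS Ω β

def SPropagation {d : ℕ} {n : Fin d → ℕ} (Ω : Set (Idx n)) : Prop :=
  ∀ β : Idx n, PS Ω β

/-- The SR-propagated set `𝒫_SR(Ω)` as an inductive predicate. -/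
inductive PSR {d : ℕ} {n : Fin d → ℕ} (Ω : Set (Idx n)) : Idx n → Prop
  | base {α : Idx n} : α ∈ Ω → PSR Ω α
  | prop {α₁ β α₂ γ : Idx n} : IsSquare α₁ β α₂ γ →
      α₁ ∈ Ω → α₂ ∈ Ω → PSR Ω β → PSR Ω γ

def SRPropagation {d : ℕ} {n : Fin d → ℕ} (Ω : Set (Idx n)) : Prop :=
  ∀ β : Idx n, PSR Ω β

/-- A sequence is strongly connected if each later element agrees with some earlier
element in exactly `d - 1` coordinates. -/
def StronglyConnected {d : ℕ} {n : Fin d → ℕ} {p : ℕ} (α : Fin p → Idx n) : Prop :=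
  ∀ k : Fin p, 0 < (k : ℕ) → ∃ i : Fin p, i < k ∧
    (Finset.univ.filter fun j : Fin d => α k j = α i j).card = d - 1

/-- A-propagation: a strongly connected sequence of elements of `Ω` covering all
coordinates. -/
def APropagation {d : ℕ} {n : Fin d → ℕ} (Ω : Set (Idx n)) : Prop :=
  ∃ (p : ℕ) (α : Fin p → Idx n), (∀ k, α k ∈ Ω) ∧ StronglyConnected α ∧
    ∀ (i : Fin d) (j : Fin (n i)), ∃ k : Fin p, α k i = j

/-- The 𝔽₂ matrix `V_Ω` whose rows are the vectors `v_α`, `α ∈ Ω`. -/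
def maskMatrix {d : ℕ} {n : Fin d → ℕ} (Ω : Finset (Idx n)) :
    Matrix {α : Idx n // α ∈ Ω} (Σ i : Fin d, Fin (n i)) (ZMod 2) :=
  Matrix.of fun α s => vF2 α.1 s

/-! ### SDP formulations -/

/-- The bordered matrix `𝐗 = [[1, xᵀ],[x, X]]`, indexed by `Option (Idx n)` where
`none` is the extra index. -/
def border {d : ℕ} {n : Fin d → ℕ} (x : Idx n → ℝ) (X : Matrix (Idx n) (Idx n) ℝ) :
    Matrix (Option (Idx n)) (Option (Idx n)) ℝ :=
  Matrix.of fun a b =>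
    match a, b with
    | Option.none, Option.none => (1 : ℝ)
    | Option.none, Option.some β => x β
    | Option.some α, Option.none => x α
    | Option.some α, Option.some β => X α β

/-- Feasibility for the exact SDP relaxation (SDP-E). -/
structure SDPEFeasible {d : ℕ} {n : Fin d → ℕ} (Ω : Set (Idx n)) (That : Idx n → ℝ)
    (x : Idx n → ℝ) (X : Matrix (Idx n) (Idx n) ℝ) : Prop where
  isSymm : X.IsSymm
  obs : ∀ α ∈ Ω, x α = That α
  obsDiag : ∀ α ∈ Ω, X α α = That α ^ 2
  squares : ∀ α₁ α₂ α₃ α₄ : Idx n, IsSquare α₁ α₂ α₃ α₄ → X α₁ α₂ = X α₃ α₄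
  psd : (border x X).PosSemidef

/-- Tightness of (SDP-E): the matrix `𝐗̄` built from the completion `T` is feasible and
is the unique minimizer of the trace objective. -/
def SDPETight {d : ℕ} {n : Fin d → ℕ} (Ω : Set (Idx n)) (That T : Idx n → ℝ) : Prop :=
  SDPEFeasible Ω That T (Matrix.vecMulVec T T) ∧
  ∀ x X, SDPEFeasible Ω That x X →
    Matrix.trace (Matrix.vecMulVec T T) ≤ Matrix.trace X ∧
    (Matrix.trace X = Matrix.trace (Matrix.vecMulVec T T) →
      x = T ∧ X = Matrix.vecMulVec T T)

/-- Tightness of the weighted relaxation (SDP-Eʷ) with weights `w`. -/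
def SDPEwTight {d : ℕ} {n : Fin d → ℕ} (Ω : Set (Idx n)) (w : Idx n → ℝ)
    (That T : Idx n → ℝ) : Prop :=
  SDPEFeasible Ω That T (Matrix.vecMulVec T T) ∧
  ∀ x X, SDPEFeasible Ω That x X →
    (∑ β : Idx n, w β * Matrix.vecMulVec T T β β) ≤ (∑ β : Idx n, w β * X β β) ∧
    ((∑ β : Idx n, w β * X β β) = (∑ β : Idx n, w β * Matrix.vecMulVec T T β β) →
      x = T ∧ X = Matrix.vecMulVec T T)

/-- Feasibility for the noisy SDP relaxation (SDP-N). -/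
structure SDPNFeasible {d : ℕ} {n : Fin d → ℕ}
    (x : Idx n → ℝ) (X : Matrix (Idx n) (Idx n) ℝ) : Prop where
  isSymm : X.IsSymm
  squares : ∀ α₁ α₂ α₃ α₄ : Idx n, IsSquare α₁ α₂ α₃ α₄ → X α₁ α₂ = X α₃ α₄
  psd : (border x X).PosSemidef

/-- Objective of (SDP-N) with noisy data `Teps` and penalty constant `c`. -/
noncomputable def sdpnObj {d : ℕ} {n : Fin d → ℕ} (Ω : Finset (Idx n))
    (Teps : Idx n → ℝ) (c : ℝ) (x : Idx n → ℝ) (X : Matrix (Idx n) (Idx n) ℝ) : ℝ :=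
  Matrix.trace X + c * ∑ α ∈ Ω, (X α α - 2 * Teps α * x α + Teps α ^ 2)

/-- Optimality for (SDP-N). -/
def SDPNOptimal {d : ℕ} {n : Fin d → ℕ} (Ω : Finset (Idx n)) (Teps : Idx n → ℝ)
    (c : ℝ) (x : Idx n → ℝ) (X : Matrix (Idx n) (Idx n) ℝ) : Prop :=
  SDPNFeasible x X ∧
    ∀ y Y, SDPNFeasible y Y → sdpnObj Ω Teps c x X ≤ sdpnObj Ω Teps c y Y

/-- Frobenius norm of a square real matrix. -/
noncomputable def frob {m : Type*} [Fintype m] (A : Matrix m m ℝ) : ℝ :=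
  Real.sqrt (∑ a : m, ∑ b : m, A a b ^ 2)

/-- `‖ε‖_∞ = max_{α ∈ Ω} |ε α|`. -/
noncomputable def supNormOn {d : ℕ} {n : Fin d → ℕ} (Ω : Finset (Idx n))
    (ε : Idx n → ℝ) : ℝ :=
  ⨆ α : {a : Idx n // a ∈ Ω}, |ε (α : Idx n)|

/-- The function `χ(s) = s + √s`. -/
noncomputable def chiFn (s : ℝ) : ℝ := s + Real.sqrt s

/-! ### Polynomial (sum of squares) machinery -/

/-- `f_α = x_α - T̂_α`. -/
noncomputable def fPoly {d : ℕ} {n : Fin d → ℕ} (That : Idx n → ℝ) (α : Idx n) :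
    MvPolynomial (Idx n) ℝ :=
  MvPolynomial.X α - MvPolynomial.C (That α)

/-- `g_α = x_α² - T̂_α²`. -/
noncomputable def gPoly {d : ℕ} {n : Fin d → ℕ} (That : Idx n → ℝ) (α : Idx n) :
    MvPolynomial (Idx n) ℝ :=
  MvPolynomial.X α ^ 2 - MvPolynomial.C (That α ^ 2)

/-- Sums of squares of polynomials. -/
def IsSOS {d : ℕ} {n : Fin d → ℕ} (p : MvPolynomial (Idx n) ℝ) : Prop :=
  ∃ (k : ℕ) (q : Fin k → MvPolynomial (Idx n) ℝ), p = ∑ i : Fin k, q i ^ 2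

/-- `Σ_{N,2}`: sums of squares of degree at most 2. -/
def SigmaN2 {d : ℕ} {n : Fin d → ℕ} (p : MvPolynomial (Idx n) ℝ) : Prop :=
  IsSOS p ∧ p.totalDegree ≤ 2

/-- The truncated ideal `I₂`, the span of the `f_α` and `g_α` for `α ∈ Ω`. -/
noncomputable def I2span {d : ℕ} {n : Fin d → ℕ} (Ω : Set (Idx n)) (That : Idx n → ℝ) :
    Submodule ℝ (MvPolynomial (Idx n) ℝ) :=
  Submodule.span ℝ
    ({p | ∃ α ∈ Ω, p = fPoly That α} ∪ {p | ∃ α ∈ Ω, p = gPoly That α})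

/-- The truncated ideal `J₂`, the span of the square relations. -/
noncomputable def J2span {d : ℕ} (n : Fin d → ℕ) : Submodule ℝ (MvPolynomial (Idx n) ℝ) :=
  Submodule.span ℝ
    {p | ∃ a b c e : Idx n, IsSquare a b c e ∧
      p = MvPolynomial.X a * MvPolynomial.X b - MvPolynomial.X c * MvPolynomial.X e}

/-- The quadratic polynomial `[1;x]ᵀ Q [1;x]` associated to a matrix `Q ∈ 𝕊^{N+1}`. -/
noncomputable def gramPoly {d : ℕ} {n : Fin d → ℕ}
    (Q : Matrix (Option (Idx n)) (Option (Idx n)) ℝ) : MvPolynomial (Idx n) ℝ :=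
  ∑ a : Option (Idx n), ∑ b : Option (Idx n),
    MvPolynomial.C (Q a b) * (Option.elim a 1 MvPolynomial.X) *
      (Option.elim b 1 MvPolynomial.X)

/-! ### Dual of the noisy SDP -/

/-- The trace inner product `A • B` of two matrices. -/
noncomputable def dotM {m : Type*} [Fintype m] (A B : Matrix m m ℝ) : ℝ :=
  ∑ a : m, ∑ b : m, A a b * B a b

/-- The indicator vector `e_α`, padded with a zero at the extra index. -/
def indVec {d : ℕ} {n : Fin d → ℕ} (α : Idx n) : Option (Idx n) → ℝ :=
  fun o => if o = some α then 1 else 0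

/-- The matrix `A_α = [-T^ε_α; e_α][-T^ε_α; e_α]ᵀ`. -/
noncomputable def Amat {d : ℕ} {n : Fin d → ℕ} (Teps : Idx n → ℝ) (α : Idx n) :
    Matrix (Option (Idx n)) (Option (Idx n)) ℝ :=
  Matrix.vecMulVec (fun o => Option.elim o (-Teps α) (fun β => if β = α then 1 else 0))
    (fun o => Option.elim o (-Teps α) (fun β => if β = α then 1 else 0))

/-- The (padded) matrix `E_{α,β} = e_α e_βᵀ + e_β e_αᵀ`. -/
noncomputable def Ebig {d : ℕ} {n : Fin d → ℕ} (a b : Idx n) :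
    Matrix (Option (Idx n)) (Option (Idx n)) ℝ :=
  Matrix.vecMulVec (indVec a) (indVec b) + Matrix.vecMulVec (indVec b) (indVec a)

/-- The matrix `[[1,0],[0,0]]`. -/
def E00 {d : ℕ} {n : Fin d → ℕ} : Matrix (Option (Idx n)) (Option (Idx n)) ℝ :=
  Matrix.of fun a b => if a = none ∧ b = none then 1 else 0

/-- The matrix `[[0,0],[0,I_N]]`. -/
def Ibot {d : ℕ} {n : Fin d → ℕ} : Matrix (Option (Idx n)) (Option (Idx n)) ℝ :=
  1 - E00

open Classical in
/-- The dual slack matrix of (dSDP-N) associated to data `(ρ, μ)`. -/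
noncomputable def dualNMatrix {d : ℕ} {n : Fin d → ℕ} (Ω : Finset (Idx n))
    (Teps : Idx n → ℝ) (c ρ : ℝ) (μ : Idx n → Idx n → Idx n → Idx n → ℝ) :
    Matrix (Option (Idx n)) (Option (Idx n)) ℝ :=
  Ibot - ρ • E00 + c • (∑ α ∈ Ω, Amat Teps α) -
    ∑ a : Idx n, ∑ b : Idx n, ∑ cc : Idx n, ∑ e : Idx n,
      (if IsSquare a b cc e then (μ a b cc e / 2) • (Ebig a b - Ebig cc e) else 0)

/-- Dual feasibility for (dSDP-N): `Q` is PSD and has the prescribed dual form. -/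
def DualNFeasible {d : ℕ} {n : Fin d → ℕ} (Ω : Finset (Idx n)) (Teps : Idx n → ℝ)
    (c : ℝ) (Q : Matrix (Option (Idx n)) (Option (Idx n)) ℝ) : Prop :=
  Q.PosSemidef ∧ ∃ (ρ : ℝ) (μ : Idx n → Idx n → Idx n → Idx n → ℝ),
    Q = dualNMatrix Ω Teps c ρ μ

/-! ### Level-based weights (Algorithm 1) -/

/-- Cumulative level sets: level 0 is `𝒫_SR(Ω)`; each next level adds the tuples
completing a square with three previously reached tuples. -/
def srLevelSet {d : ℕ} {n : Fin d → ℕ} (Ω : Set (Idx n)) : ℕ → Set (Idx n)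
  | 0 => {β | PSR Ω β}
  | (ℓ + 1) => srLevelSet Ω ℓ ∪ {β | ∃ a b c : Idx n,
      a ∈ srLevelSet Ω ℓ ∧ b ∈ srLevelSet Ω ℓ ∧ c ∈ srLevelSet Ω ℓ ∧ IsSquare a b c β}

/-- The level-based weight vector `w(ϑ)`: `w(ϑ)_β = ϑ^ℓ` where `ℓ` is the first level
containing `β`. -/
noncomputable def levelWeight {d : ℕ} {n : Fin d → ℕ} (Ω : Set (Idx n)) (θ : ℝ)
    (β : Idx n) : ℝ :=
  θ ^ sInf {ℓ : ℕ | β ∈ srLevelSet Ω ℓ}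

/-! ### Random masks -/

/-- The Bernoulli measure on `Bool` with success probability `p`. -/
noncomputable def bern (p : ℝ) : Measure Bool :=
  (ENNReal.ofReal p) • Measure.dirac true + (ENNReal.ofReal (1 - p)) • Measure.dirac false


/-! ### Gram matrices and sums of squares -/

section Gram

variable {d : ℕ} {n : Fin d → ℕ}

/-- The affine polynomial with coefficient vector `v` in the monomials `[1; x]`. -/
noncomputable def affinePoly (v : Option (Idx n) → ℝ) : MvPolynomial (Idx n) ℝ :=
  ∑ a : Option (Idx n), MvPolynomial.C (v a) * Option.elim a 1 MvPolynomial.X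

/-- The point `[1; T]`. -/
def liftPoint (T : Idx n → ℝ) : Option (Idx n) → ℝ := fun o => o.elim 1 T

/-- The coefficient vector of `x_β - T_β`. -/
def diffVec (T : Idx n → ℝ) (β : Idx n) : Option (Idx n) → ℝ :=
  fun o => o.elim (-T β) (Pi.single β 1)

theorem gramPoly_add (P Q : Matrix (Option (Idx n)) (Option (Idx n)) ℝ) :
    gramPoly (P + Q) = gramPoly P + gramPoly Q := by
  simp only [gramPoly, Matrix.add_apply, map_add, add_mul, Finset.sum_add_distrib]

theorem gramPoly_smul (c : ℝ) (Q : Matrix (Option (Idx n)) (Option (Idx n)) ℝ) :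
    gramPoly (c • Q) = c • gramPoly Q := by
  simp only [gramPoly, Matrix.smul_apply, smul_eq_mul, map_mul, MvPolynomial.smul_eq_C_mul,
    Finset.mul_sum, mul_assoc]

/-- `gramPoly` as a linear map. -/
noncomputable def gramPolyLin :
    Matrix (Option (Idx n)) (Option (Idx n)) ℝ →ₗ[ℝ] MvPolynomial (Idx n) ℝ where
  toFun := gramPoly
  map_add' := gramPoly_add
  map_smul' := gramPoly_smul

theorem gramPoly_sum {ι : Type*} (s : Finset ι)
    (Q : ι → Matrix (Option (Idx n)) (Option (Idx n)) ℝ) :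
    gramPoly (∑ i ∈ s, Q i) = ∑ i ∈ s, gramPoly (Q i) :=
  map_sum (gramPolyLin (n := n)) Q s

theorem gramPoly_vecMulVec (v : Option (Idx n) → ℝ) :
    gramPoly (Matrix.vecMulVec v v) = affinePoly v ^ 2 := by
  simp only [gramPoly, affinePoly, sq, Finset.sum_mul_sum, Matrix.vecMulVec_apply, map_mul]
  exact Finset.sum_congr rfl fun a _ => Finset.sum_congr rfl fun b _ => by ring

theorem affinePoly_add (v w : Option (Idx n) → ℝ) :
    affinePoly (v + w) = affinePoly v + affinePoly w := by
  simp only [affinePoly, Pi.add_apply, map_add, add_mul, Finset.sum_add_distrib]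

theorem affinePoly_smul (c : ℝ) (v : Option (Idx n) → ℝ) :
    affinePoly (c • v) = MvPolynomial.C c * affinePoly v := by
  simp only [affinePoly, Pi.smul_apply, smul_eq_mul, map_mul, Finset.mul_sum, mul_assoc]

theorem affinePoly_diffVec (T : Idx n → ℝ) (β : Idx n) :
    affinePoly (diffVec T β) = MvPolynomial.X β - MvPolynomial.C (T β) := by
  classical
  have h : ∀ a : Idx n, MvPolynomial.C (Pi.single (M := fun _ => ℝ) β 1 a) *
      (MvPolynomial.X a : MvPolynomial (Idx n) ℝ) =
      if a = β then MvPolynomial.X a else 0 := by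
    intro a
    by_cases hab : a = β
    · subst hab; simp
    · simp [hab]
  rw [affinePoly, Fintype.sum_option]
  simp only [diffVec, Option.elim, h]
  simp only [Finset.sum_ite_eq', Finset.mem_univ, if_true, map_neg]
  ring

theorem diffVec_dotProduct (T : Idx n → ℝ) (β : Idx n) (v : Option (Idx n) → ℝ) :
    dotProduct (diffVec T β) v = v (some β) - T β * v none := by
  rw [dotProduct, Fintype.sum_option]
  simp only [diffVec, Option.elim, Pi.single_apply, ite_mul, one_mul, zero_mul,
    Finset.sum_ite_eq', Finset.mem_univ, if_true]
  ring

theorem diffVec_dotProduct_liftPoint (T : Idx n → ℝ) (β : Idx n) :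
    dotProduct (diffVec T β) (liftPoint T) = 0 := by
  simp [diffVec_dotProduct, liftPoint]

theorem vecMulVec_mulVec_eq_zero {ι : Type*} [Fintype ι] {v w : ι → ℝ}
    (h : dotProduct v w = 0) : (Matrix.vecMulVec v v).mulVec w = 0 := by
  ext i
  simp [Matrix.vecMulVec_mulVec, h]

theorem posSemidef_vecMulVec_self {ι : Type*} [Fintype ι] (v : ι → ℝ) :
    (Matrix.vecMulVec v v).PosSemidef := by
  simpa using Matrix.posSemidef_vecMulVec_self_star v

/-- The Gram matrix of `∑ β, c β * (x_β - T_β) ^ 2`. -/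
noncomputable def diffGram (T c : Idx n → ℝ) : Matrix (Option (Idx n)) (Option (Idx n)) ℝ :=
  ∑ β : Idx n, c β • Matrix.vecMulVec (diffVec T β) (diffVec T β)

theorem gramPoly_diffGram (T c : Idx n → ℝ) :
    gramPoly (diffGram T c) = ∑ β : Idx n, MvPolynomial.C (c β) *
      (MvPolynomial.X β - MvPolynomial.C (T β)) ^ 2 := by
  simp only [diffGram, gramPoly_sum, gramPoly_smul, gramPoly_vecMulVec, affinePoly_diffVec,
    MvPolynomial.smul_eq_C_mul]

theorem posSemidef_diffGram (T : Idx n → ℝ) {c : Idx n → ℝ} (hc : ∀ β, 0 ≤ c β) :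
    (diffGram T c).PosSemidef :=
  Matrix.posSemidef_sum _ fun β _ => (posSemidef_vecMulVec_self _).smul (hc β)

theorem diffGram_mulVec_liftPoint (T c : Idx n → ℝ) :
    (diffGram T c).mulVec (liftPoint T) = 0 := by
  simp only [diffGram, Matrix.sum_mulVec, Matrix.smul_mulVec,
    vecMulVec_mulVec_eq_zero (diffVec_dotProduct_liftPoint T _), smul_zero,
    Finset.sum_const_zero]

theorem dotProduct_diffGram_mulVec (T c : Idx n → ℝ) (v : Option (Idx n) → ℝ) :
    dotProduct v ((diffGram T c).mulVec v) =
      ∑ β : Idx n, c β * (v (some β) - T β * v none) ^ 2 := by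
  simp only [diffGram, Matrix.sum_mulVec, Matrix.smul_mulVec, dotProduct_sum, dotProduct_smul,
    Matrix.vecMulVec_mulVec, diffVec_dotProduct, smul_eq_mul]
  refine Finset.sum_congr rfl fun β _ => ?_
  rw [op_smul_eq_smul, dotProduct_comm v, diffVec_dotProduct, smul_eq_mul]
  ring

theorem totalDegree_gramPoly_le (Q : Matrix (Option (Idx n)) (Option (Idx n)) ℝ) :
    (gramPoly Q).totalDegree ≤ 2 := by
  have h : ∀ a : Option (Idx n),
      (Option.elim a 1 MvPolynomial.X : MvPolynomial (Idx n) ℝ).totalDegree ≤ 1 := by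
    rintro (_ | a)
    · simp
    · simp
  refine MvPolynomial.totalDegree_finsetSum_le fun a _ =>
    MvPolynomial.totalDegree_finsetSum_le fun b _ => ?_
  refine (MvPolynomial.totalDegree_mul _ _).trans ?_
  refine (Nat.add_le_add_right (MvPolynomial.totalDegree_mul _ _) _).trans ?_
  rw [MvPolynomial.totalDegree_C]
  have := h a
  have := h b
  omega

theorem sigmaN2_gramPoly {Q : Matrix (Option (Idx n)) (Option (Idx n)) ℝ}
    (hQ : Q.PosSemidef) : SigmaN2 (gramPoly Q) := by
  refine ⟨?_, totalDegree_gramPoly_le Q⟩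
  obtain ⟨m, v, rfl⟩ := Matrix.posSemidef_iff_eq_sum_vecMulVec.mp hQ
  refine ⟨m, fun i => affinePoly (v i), ?_⟩
  simp only [star_trivial, gramPoly_sum, gramPoly_vecMulVec]

/-- A positive semidefinite matrix annihilating `[1; T]` has corank one after adding the Gram
matrix of a positive combination of the `(x_β - T_β) ^ 2`. -/
theorem rank_diffGram_add (T : Idx n → ℝ) {c : Idx n → ℝ} (hc : ∀ β, 0 < c β)
    {Q : Matrix (Option (Idx n)) (Option (Idx n)) ℝ} (hQ : Q.PosSemidef)
    (hQT : Q.mulVec (liftPoint T) = 0) :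
    (diffGram T c + Q).rank = Fintype.card (Idx n) := by
  have hker : LinearMap.ker (diffGram T c + Q).mulVecLin = ℝ ∙ liftPoint T := by
    ext v
    rw [LinearMap.mem_ker, Matrix.mulVecLin_apply, Submodule.mem_span_singleton]
    constructor
    · intro h
      have h0 : dotProduct v ((diffGram T c + Q).mulVec v) = 0 := by rw [h, dotProduct_zero]
      rw [Matrix.add_mulVec, dotProduct_add, dotProduct_diffGram_mulVec] at h0
      have hQv : 0 ≤ dotProduct v (Q.mulVec v) := by
        simpa using hQ.dotProduct_mulVec_nonneg v
      have hterm : ∀ β ∈ Finset.univ, 0 ≤ c β * (v (some β) - T β * v none) ^ 2 :=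
        fun β _ => mul_nonneg (hc β).le (sq_nonneg _)
      have hsum := Finset.sum_nonneg hterm
      have hzero := (Finset.sum_eq_zero_iff_of_nonneg hterm).mp (by linarith)
      refine ⟨v none, ?_⟩
      ext (_ | β)
      · simp [liftPoint]
      · have := hzero β (Finset.mem_univ β)
        have := (mul_eq_zero.mp this).resolve_left (hc β).ne'
        have := pow_eq_zero_iff (two_ne_zero) |>.mp this
        simp only [liftPoint, Pi.smul_apply, Option.elim, smul_eq_mul]
        linarith
    · rintro ⟨r, rfl⟩
      rw [Matrix.mulVec_smul, Matrix.add_mulVec, diffGram_mulVec_liftPoint, hQT, add_zero,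
        smul_zero]
  have hne : liftPoint T ≠ 0 := fun h => one_ne_zero (α := ℝ) (congrFun h none)
  have := LinearMap.finrank_range_add_finrank_ker (diffGram T c + Q).mulVecLin
  rw [hker, finrank_span_singleton hne, Module.finrank_fintype_fun_eq_card,
    Fintype.card_option] at this
  exact Nat.add_right_cancel this

end Gram

/-! ### Polynomials that vanish up to arbitrarily small squares -/

section Slack

variable {d : ℕ} {n : Fin d → ℕ}

/-- `p + ε ∑ (x_β - T_β)²` is, modulo `M`, a sum of squares of affine polynomials vanishing
at `T`. -/
def SOSWithSlack (M : Submodule ℝ (MvPolynomial (Idx n) ℝ)) (T : Idx n → ℝ)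
    (p : MvPolynomial (Idx n) ℝ) (ε : ℝ) : Prop :=
  ∃ Q : Matrix (Option (Idx n)) (Option (Idx n)) ℝ, Q.PosSemidef ∧
    Q.mulVec (liftPoint T) = 0 ∧ p + gramPoly (diffGram T fun _ => ε) - gramPoly Q ∈ M

theorem SOSWithSlack.add {M : Submodule ℝ (MvPolynomial (Idx n) ℝ)} {T : Idx n → ℝ}
    {p q : MvPolynomial (Idx n) ℝ} {ε δ : ℝ} (hp : SOSWithSlack M T p ε)
    (hq : SOSWithSlack M T q δ) : SOSWithSlack M T (p + q) (ε + δ) := by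
  obtain ⟨P, hP, hPT, hPM⟩ := hp
  obtain ⟨Q, hQ, hQT, hQM⟩ := hq
  refine ⟨P + Q, hP.add hQ, by rw [Matrix.add_mulVec, hPT, hQT, add_zero], ?_⟩
  convert M.add_mem hPM hQM using 1
  simp only [gramPoly_add, gramPoly_diffGram, map_add, add_mul, Finset.sum_add_distrib]
  ring

theorem SOSWithSlack.of_mem {M : Submodule ℝ (MvPolynomial (Idx n) ℝ)} (T : Idx n → ℝ)
    {p : MvPolynomial (Idx n) ℝ} (hp : p ∈ M) {ε : ℝ} (hε : 0 ≤ ε) : SOSWithSlack M T p ε :=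
  ⟨diffGram T fun _ => ε, posSemidef_diffGram T fun _ => hε, diffGram_mulVec_liftPoint T _,
    by simpa using hp⟩

/-- The subspace of polynomials all of whose multiples become sums of squares modulo `M` after
adding an arbitrarily small multiple of `∑ (x_β - T_β)²`. -/
def slackSubmodule (M : Submodule ℝ (MvPolynomial (Idx n) ℝ)) (T : Idx n → ℝ) :
    Submodule ℝ (MvPolynomial (Idx n) ℝ) where
  carrier := {p | ∀ c ε : ℝ, 0 < ε → SOSWithSlack M T (c • p) ε}
  add_mem' := by
    intro p q hp hq c ε hε
    have := (hp c (ε / 2) (half_pos hε)).add (hq c (ε / 2) (half_pos hε))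
    rwa [add_halves, ← smul_add] at this
  zero_mem' := by
    intro c ε hε
    rw [smul_zero]
    exact .of_mem T M.zero_mem hε.le
  smul_mem' := by
    intro r p hp c ε hε
    rw [smul_smul]
    exact hp (c * r) ε hε

theorem le_slackSubmodule (M : Submodule ℝ (MvPolynomial (Idx n) ℝ)) (T : Idx n → ℝ) :
    M ≤ slackSubmodule M T :=
  fun _ hp c _ hε => .of_mem T (M.smul_mem c hp) hε.le

/-- If `(x_a - T_a)²` vanishes modulo `M`, then `(x_a - T_a) (x_b - T_b)` vanishes up to slack. -/
theorem mul_mem_slackSubmodule {M : Submodule ℝ (MvPolynomial (Idx n) ℝ)} {T : Idx n → ℝ}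
    {a : Idx n} (ha : (MvPolynomial.X a - MvPolynomial.C (T a)) ^ 2 ∈ M) (b : Idx n) :
    (MvPolynomial.X a - MvPolynomial.C (T a)) * (MvPolynomial.X b - MvPolynomial.C (T b)) ∈
      slackSubmodule M T := by
  classical
  intro c ε hε
  set r := c / (2 * ε) with hr
  set u := diffVec T b + r • diffVec T a with hu
  have hrest : ∀ β, 0 ≤ (if β = b then 0 else ε) := fun β => by split_ifs <;> linarith
  refine ⟨ε • Matrix.vecMulVec u u + diffGram T fun β => if β = b then 0 else ε,
    ((posSemidef_vecMulVec_self _).smul hε.le).add (posSemidef_diffGram T hrest), ?_, ?_⟩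
  · have : dotProduct u (liftPoint T) = 0 := by
      rw [hu, add_dotProduct, smul_dotProduct, diffVec_dotProduct_liftPoint,
        diffVec_dotProduct_liftPoint, smul_zero, add_zero]
    rw [Matrix.add_mulVec, Matrix.smul_mulVec, vecMulVec_mulVec_eq_zero this,
      diffGram_mulVec_liftPoint, smul_zero, add_zero]
  · have herase : ∑ β ∈ Finset.univ.erase b, MvPolynomial.C (if β = b then 0 else ε) *
          (MvPolynomial.X β - MvPolynomial.C (T β)) ^ 2 =
        ∑ β ∈ Finset.univ.erase b, MvPolynomial.C ε *
          (MvPolynomial.X β - MvPolynomial.C (T β)) ^ 2 :=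
      Finset.sum_congr rfl fun β hβ => by rw [if_neg (Finset.ne_of_mem_erase hβ)]
    have hsplit : gramPoly (diffGram T fun _ => ε) =
        gramPoly (diffGram T fun β => if β = b then 0 else ε) +
          MvPolynomial.C ε * (MvPolynomial.X b - MvPolynomial.C (T b)) ^ 2 := by
      rw [gramPoly_diffGram, gramPoly_diffGram, ← Finset.add_sum_erase _ _ (Finset.mem_univ b),
        ← Finset.add_sum_erase (a := b) (f := fun β => MvPolynomial.C (if β = b then 0 else ε) *
          (MvPolynomial.X β - MvPolynomial.C (T β)) ^ 2) _ (Finset.mem_univ b), herase]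
      simp only [if_true, map_zero, zero_mul, zero_add]
      ring
    have hc : MvPolynomial.C (σ := Idx n) c =
        MvPolynomial.C 2 * MvPolynomial.C ε * MvPolynomial.C r := by
      rw [← map_mul, ← map_mul, hr]
      congr 1
      field_simp
    convert M.smul_mem (-(ε * r ^ 2)) ha using 1
    rw [hsplit, gramPoly_add, gramPoly_smul, gramPoly_vecMulVec, hu, affinePoly_add,
      affinePoly_smul, affinePoly_diffVec, affinePoly_diffVec]
    simp only [MvPolynomial.smul_eq_C_mul, map_neg, map_mul, map_pow, hc]
    rw [show (MvPolynomial.C 2 : MvPolynomial (Idx n) ℝ) = 2 from map_ofNat _ 2]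
    ring

end Slack

/-! ### Propagation -/

section Propagation

variable {d : ℕ} {n : Fin d → ℕ}

theorem IsRankOne.mul_eq_mul {T : Idx n → ℝ} (hT : IsRankOne T) {a b c e : Idx n}
    (h : IsSquare a b c e) : T a * T b = T c * T e := by
  obtain ⟨u, hu⟩ := hT
  simp only [hu, ← Finset.prod_mul_distrib]
  refine Finset.prod_congr rfl fun k _ => ?_
  obtain ⟨h1, h2⟩ := h.2 k
  have : (a k = c k ∧ b k = e k) ∨ (a k = e k ∧ b k = c k) := by
    rcases le_total (a k) (b k) with h3 | h3 <;> rcases le_total (c k) (e k) with h4 | h4 <;>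
      simp only [max_eq_left, max_eq_right, min_eq_left, min_eq_right, h3, h4] at h1 h2 <;>
      simp [h1, h2]
  rcases this with ⟨h3, h4⟩ | ⟨h3, h4⟩
  · rw [h3, h4]
  · rw [h3, h4, mul_comm]

theorem PSR.nonempty {Ω : Set (Idx n)} {β : Idx n} (h : PSR Ω β) : Ω.Nonempty := by
  cases h with
  | base h => exact ⟨_, h⟩
  | prop _ h _ _ => exact ⟨_, h⟩

variable {Ω : Set (Idx n)} {That T : Idx n → ℝ}

theorem X_sub_C_mem (hTm : ∀ α ∈ Ω, T α = That α) {a : Idx n} (ha : a ∈ Ω) :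
    MvPolynomial.X a - MvPolynomial.C (T a) ∈ I2span Ω That ⊔ J2span n :=
  Submodule.mem_sup_left (Submodule.subset_span (Or.inl ⟨a, ha, by rw [fPoly, hTm a ha]⟩))

theorem X_sq_sub_C_mem (hTm : ∀ α ∈ Ω, T α = That α) {a : Idx n} (ha : a ∈ Ω) :
    MvPolynomial.X a ^ 2 - MvPolynomial.C (T a ^ 2) ∈ I2span Ω That ⊔ J2span n :=
  Submodule.mem_sup_left (Submodule.subset_span (Or.inr ⟨a, ha, by rw [gPoly, hTm a ha]⟩))

theorem sq_X_sub_C_mem (hTm : ∀ α ∈ Ω, T α = That α) {a : Idx n} (ha : a ∈ Ω) :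
    (MvPolynomial.X a - MvPolynomial.C (T a)) ^ 2 ∈ I2span Ω That ⊔ J2span n := by
  convert Submodule.sub_mem _ (X_sq_sub_C_mem hTm ha)
    (Submodule.smul_mem _ (2 * T a) (X_sub_C_mem hTm ha)) using 1
  simp only [MvPolynomial.smul_eq_C_mul, map_mul, map_pow]
  rw [show (MvPolynomial.C 2 : MvPolynomial (Idx n) ℝ) = 2 from map_ofNat _ 2]
  ring

theorem X_mul_X_sub_mem_slackSubmodule (hTm : ∀ α ∈ Ω, T α = That α) {a : Idx n} (ha : a ∈ Ω)
    (b : Idx n) :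
    MvPolynomial.X a * MvPolynomial.X b - MvPolynomial.C (T a) * MvPolynomial.X b ∈
      slackSubmodule (I2span Ω That ⊔ J2span n) T := by
  convert Submodule.add_mem _ (mul_mem_slackSubmodule (sq_X_sub_C_mem hTm ha) b)
    (Submodule.smul_mem _ (T b) (le_slackSubmodule _ T (X_sub_C_mem hTm ha))) using 1
  rw [MvPolynomial.smul_eq_C_mul]
  ring

theorem PSR.X_sub_C_mem_slackSubmodule (hnz : ∀ α ∈ Ω, That α ≠ 0) (hT : IsRankOne T)
    (hTm : ∀ α ∈ Ω, T α = That α) {β : Idx n} (hβ : PSR Ω β) :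
    MvPolynomial.X β - MvPolynomial.C (T β) ∈
      slackSubmodule (I2span Ω That ⊔ J2span n) T := by
  induction hβ with
  | base h => exact le_slackSubmodule _ T (X_sub_C_mem hTm h)
  | @prop a b c e hsq ha hc _ ih =>
    have hc0 : T c ≠ 0 := by rw [hTm c hc]; exact hnz c hc
    have hJ : MvPolynomial.X a * MvPolynomial.X b - MvPolynomial.X c * MvPolynomial.X e ∈
        slackSubmodule (I2span Ω That ⊔ J2span n) T :=
      le_slackSubmodule _ T (Submodule.mem_sup_right
        (Submodule.subset_span ⟨a, b, c, e, hsq, rfl⟩))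
    have hac := X_mul_X_sub_mem_slackSubmodule hTm ha b
    have hce := X_mul_X_sub_mem_slackSubmodule hTm hc e
    have hmul : MvPolynomial.C (σ := Idx n) (T a) * MvPolynomial.C (T b) =
        MvPolynomial.C (T c) * MvPolynomial.C (T e) := by
      rw [← map_mul, hT.mul_eq_mul hsq, map_mul]
    rw [← Submodule.smul_mem_iff _ hc0]
    convert Submodule.add_mem _ (Submodule.sub_mem _ (Submodule.sub_mem _ hac hce) hJ)
      (Submodule.smul_mem _ (T a) ih) using 1
    · simp only [MvPolynomial.smul_eq_C_mul]
      linear_combination hmul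

/-- Modulo slack, `ξ (x_β² - T_β²)` is `ζ (x_β - (T_β / T_a) x_a)² + (ξ - ζ) (x_β - T_β)²`. -/
theorem sq_sub_mem_slackSubmodule (hnz : ∀ α ∈ Ω, That α ≠ 0) (hT : IsRankOne T)
    (hTm : ∀ α ∈ Ω, T α = That α) {β a : Idx n} (hβ : PSR Ω β) (ha : a ∈ Ω) (ξ ζ : ℝ) :
    MvPolynomial.C ξ * (MvPolynomial.X β ^ 2 - MvPolynomial.C (T β ^ 2)) -
      MvPolynomial.C ζ *
        (MvPolynomial.X β - MvPolynomial.C (T β / T a) * MvPolynomial.X a) ^ 2 -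
      MvPolynomial.C (ξ - ζ) * (MvPolynomial.X β - MvPolynomial.C (T β)) ^ 2 ∈
      slackSubmodule (I2span Ω That ⊔ J2span n) T := by
  have ha0 : T a ≠ 0 := by rw [hTm a ha]; exact hnz a ha
  set t := T β / T a with ht
  have hta : MvPolynomial.C (σ := Idx n) (T β) = MvPolynomial.C t * MvPolynomial.C (T a) := by
    rw [← map_mul, ht, div_mul_cancel₀ _ ha0]
  convert Submodule.add_mem _
    (Submodule.smul_mem _ (2 * ξ * T β) (hβ.X_sub_C_mem_slackSubmodule hnz hT hTm))
    (Submodule.sub_mem _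
      (Submodule.smul_mem _ (2 * ζ * t) (X_mul_X_sub_mem_slackSubmodule hTm ha β))
      (Submodule.smul_mem _ (ζ * t ^ 2) (le_slackSubmodule _ T (X_sq_sub_C_mem hTm ha)))) using 1
  simp only [MvPolynomial.smul_eq_C_mul, map_mul, map_pow, map_sub, hta]
  rw [show (MvPolynomial.C 2 : MvPolynomial (Idx n) ℝ) = 2 from map_ofNat _ 2]
  ring

end Propagation

/-- Under SR-propagation, for any positive `ξ_β` and any `η > 0` there
are positive `η_β ∈ [ξ_β - η, ξ_β]`, indices `α_β ∈ Ω`, `p̃ ∈ Σ_{N,2}`, and an SOS `σ`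
with a rank-`N` Gram matrix such that
`Σ_β ξ_β (x_β² - T_β²) = Σ_β η_β (x_β - (T_β/T_{α_β}) x_{α_β})² + p̃ = σ mod (I₂+J₂)`. -/
theorem statement14 {d : ℕ} {n : Fin d → ℕ} (Ω : Set (Idx n)) (That : Idx n → ℝ)
    (hSR : SRPropagation Ω) (hnz : ∀ α ∈ Ω, That α ≠ 0)
    (T : Idx n → ℝ) (hT : IsRankOne T) (hTm : ∀ α ∈ Ω, T α = That α)
    (huniq : ∀ T' : Idx n → ℝ, IsRankOne T' → (∀ α ∈ Ω, T' α = That α) → T' = T)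
    (ξ : Idx n → ℝ) (hξ : ∀ β, 0 < ξ β) (η : ℝ) (hη : 0 < η) :
    ∃ (ηc : Idx n → ℝ) (amap : Idx n → Idx n)
      (ptil σ : MvPolynomial (Idx n) ℝ)
      (Q : Matrix (Option (Idx n)) (Option (Idx n)) ℝ),
      (∀ β, 0 < ηc β ∧ ηc β ∈ Set.Icc (ξ β - η) (ξ β)) ∧
      (∀ β, amap β ∈ Ω) ∧
      SigmaN2 ptil ∧ SigmaN2 σ ∧
      Q.PosSemidef ∧ σ = gramPoly Q ∧ Q.rank = Fintype.card (Idx n) ∧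
      ((∑ β : Idx n, MvPolynomial.C (ξ β) *
            (MvPolynomial.X β ^ 2 - MvPolynomial.C (T β ^ 2))) -
          ((∑ β : Idx n, MvPolynomial.C (ηc β) *
            (MvPolynomial.X β - MvPolynomial.C (T β / T (amap β)) *
              MvPolynomial.X (amap β)) ^ 2) + ptil)
        ∈ I2span Ω That ⊔ J2span n) ∧
      ((∑ β : Idx n, MvPolynomial.C (ξ β) *
            (MvPolynomial.X β ^ 2 - MvPolynomial.C (T β ^ 2))) - σ
        ∈ I2span Ω That ⊔ J2span n) := by
  obtain ⟨δ, hδ, hδη, hδξ⟩ : ∃ δ : ℝ, 0 < δ ∧ δ ≤ η ∧ ∀ β, δ < ξ β := by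
    cases isEmpty_or_nonempty (Idx n) with
    | inl h => exact ⟨η, hη, le_rfl, fun β => isEmptyElim β⟩
    | inr h =>
      obtain ⟨β₀, hβ₀⟩ := Finite.exists_min ξ
      have := hξ β₀
      refine ⟨min η (ξ β₀ / 2), lt_min hη (half_pos this), min_le_left _ _, fun β => ?_⟩
      have := hβ₀ β
      have := min_le_right η (ξ β₀ / 2)
      linarith
  choose amap hamap using fun β => (hSR β).nonempty
  obtain ⟨P, hP, -, hPM⟩ := Submodule.sum_mem (t := Finset.univ) _ (fun β _ =>
    sq_sub_mem_slackSubmodule hnz hT hTm (hSR β) (hamap β) (ξ β) (ξ β - δ)) 1 δ hδ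
  obtain ⟨Q, hQ, hQT, hQM⟩ := Submodule.sum_mem (t := Finset.univ) _ (fun β _ =>
    Submodule.smul_mem _ (2 * ξ β * T β)
      ((hSR β).X_sub_C_mem_slackSubmodule hnz hT hTm)) 1 δ hδ
  have hpos : ∀ β, 0 < ξ β - δ := fun β => sub_pos.mpr (hδξ β)
  have hG := (posSemidef_diffGram T fun β => (hpos β).le).add hQ
  refine ⟨fun β => ξ β - δ, amap, gramPoly P, _, _, fun β => ⟨hpos β, by linarith, by linarith⟩,
    hamap, sigmaN2_gramPoly hP, sigmaN2_gramPoly hG, hG, rfl, rank_diffGram_add T hpos hQ hQT,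
    ?_, ?_⟩
  · convert hPM using 1
    simp only [one_smul, gramPoly_diffGram, Finset.sum_sub_distrib, sub_sub_cancel]
    ring
  · convert hQM using 1
    rw [one_smul, gramPoly_add, ← sub_sub]
    congr 1
    rw [gramPoly_diffGram, gramPoly_diffGram, ← Finset.sum_sub_distrib, ← Finset.sum_add_distrib]
    refine Finset.sum_congr rfl fun β _ => ?_
    simp only [MvPolynomial.smul_eq_C_mul, map_mul, map_pow, map_sub]
    rw [show (MvPolynomial.C 2 : MvPolynomial (Idx n) ℝ) = 2 from map_ofNat _ 2]
    ring

end RankOneTC
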